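/- Suppose that for every fundamental point m of c with m ≥ 138 there exists a least fundamental point m' > m, and that the largest index ρ ≤ m' with c(ρ) - c(ρ-1) > 1 satisfies ρ ≤ (5/4)(m + 3). Then there are infinitely many pairs of twin primes. -/

import Mathlib

/-- The sequence `c` from the paper: `c 1 = 2` and, for `n ≥ 2`,
`c n = c (n-1) + gcd (n, c (n-1))` if `n` is even, and
`c n = c (n-1) + gcd (n-2, c (n-1))` if `n` is odd. -/
def c : ℕ → ℕ
  | 0 => 0
  | 1 => 2
  | n + 2 =>
    c (n + 1) +
      (if (n + 2) % 2 = 0 then Nat.gcd (n + 2) (c (n + 1)) else Nat.gcd n (c (n + 1)))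

/-- A fundamental point of `c`: an integer `n ≥ 2` with `c n = 2 n`. -/
def IsFundamentalC (n : ℕ) : Prop := 2 ≤ n ∧ c n = 2 * n

theorem c_add_two_of_even {n : ℕ} (h : n % 2 = 0) :
    c (n + 2) = c (n + 1) + Nat.gcd (n + 2) (c (n + 1)) := by
  have h2 : (n + 2) % 2 = 0 := by lia
  rw [c, if_pos h2]

theorem c_add_two_of_odd {n : ℕ} (h : n % 2 = 1) :
    c (n + 2) = c (n + 1) + Nat.gcd n (c (n + 1)) := by
  have h2 : ¬ (n + 2) % 2 = 0 := by lia
  rw [c, if_neg h2]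

theorem c_lt_c_succ (n : ℕ) : c n < c (n + 1) := by
  rcases n with _ | n
  · simp [c]
  · rcases Nat.mod_two_eq_zero_or_one n with h | h
    · rw [c_add_two_of_even h]
      have := Nat.gcd_pos_of_pos_left (c (n + 1)) (show 0 < n + 2 by lia)
      lia
    · rw [c_add_two_of_odd h]
      have := Nat.gcd_pos_of_pos_left (c (n + 1)) (show 0 < n by lia)
      lia

theorem c_add_le (a k : ℕ) : c a + k ≤ c (a + k) := by
  induction k with
  | zero => simp
  | succ k ih =>
    have := c_lt_c_succ (a + k)
    rw [← add_assoc a k 1]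
    lia

theorem isFundamentalC_138 : IsFundamentalC 138 := ⟨by norm_num, by decide +kernel⟩

theorem c_add_one_of_fundamental {m : ℕ} (hm : IsFundamentalC m) (h6 : 6 ∣ m) :
    c (m + 1) = 2 * m + 1 := by
  obtain ⟨h2, hc⟩ := hm
  obtain ⟨n, rfl⟩ : ∃ n, m = n + 1 := ⟨m - 1, by lia⟩
  rw [c_add_two_of_odd (n := n) (by lia), hc]
  have hg : Nat.gcd n (2 * (n + 1)) ∣ 2 := by
    have h := Nat.dvd_sub (Nat.gcd_dvd_right n (2 * (n + 1)))
      ((Nat.gcd_dvd_left n (2 * (n + 1))).mul_left 2)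
    rwa [show 2 * (n + 1) - 2 * n = 2 by lia] at h
  rcases (Nat.dvd_prime Nat.prime_two).1 hg with h | h
  · rw [h]
  · have := h ▸ Nat.gcd_dvd_left n (2 * (n + 1))
    lia

theorem c_add_two_of_fundamental {m : ℕ} (hm : IsFundamentalC m) (h6 : 6 ∣ m) :
    c (m + 2) = 2 * m + 2 := by
  rw [c_add_two_of_even (by lia), c_add_one_of_fundamental hm h6]
  have hg : Nat.gcd (m + 2) (2 * m + 1) ∣ 3 := by
    have h := Nat.dvd_sub ((Nat.gcd_dvd_left (m + 2) (2 * m + 1)).mul_left 2)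
      (Nat.gcd_dvd_right (m + 2) (2 * m + 1))
    rwa [show 2 * (m + 2) - (2 * m + 1) = 3 by lia] at h
  rcases (Nat.dvd_prime Nat.prime_three).1 hg with h | h
  · rw [h]
  · have := h ▸ Nat.gcd_dvd_left (m + 2) (2 * m + 1)
    lia

theorem c_add_three_of_fundamental {m : ℕ} (hm : IsFundamentalC m) (h6 : 6 ∣ m) :
    c (m + 3) = 3 * m + 3 := by
  rw [c_add_two_of_odd (n := m + 1) (by lia), c_add_two_of_fundamental hm h6,
    show 2 * m + 2 = 2 * (m + 1) by ring, Nat.gcd_mul_left_right]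
  lia

/-- When `c` increases by one from `r` up to a fundamental point `m` lying far enough beyond `r`,
the neighbours of `m` are twin primes. -/
theorem prime_pred_and_prime_succ_of_fundamental {r m : ℕ} (hm : IsFundamentalC m)
    (h8 : 8 ≤ m) (hr : 1 ≤ r) (hrm : r ≤ m)
    (hlen : 4 * (m + 1) ≤ (m - r) ^ 2)
    (hstep : ∀ n, r < n → n ≤ m → c n = c (n - 1) + 1) :
    Nat.Prime (m - 1) ∧ Nat.Prime (m + 1) := by
  have hc : ∀ k, r + k ≤ m → c (r + k) = c r + k := by
    intro k
    induction k with
    | zero => simp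
    | succ k ih =>
      intro hk
      rw [hstep (r + (k + 1)) (by lia) hk, show r + (k + 1) - 1 = r + k by lia,
        ih (by lia)]
      ring
  have hcr : c r = m + r := by
    have h := hc (m - r) (by lia)
    rw [Nat.add_sub_cancel' hrm, hm.2] at h
    lia
  have hval : ∀ n, r ≤ n → n ≤ m → c n = m + n := by
    intro n h1 h2
    have h := hc (n - r) (by lia)
    rw [Nat.add_sub_cancel' h1] at h
    lia
  have hmr : 4 ≤ m - r := by nlinarith
  have heven : ∀ n d, r < n → n ≤ m → n % 2 = 0 → d ∣ n → d ∣ m - 1 → d = 1 := by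
    intro n d h1 h2 h3 hd hd'
    have hs := hstep n h1 h2
    obtain ⟨k, rfl⟩ : ∃ k, n = k + 2 := ⟨n - 2, by lia⟩
    rw [c_add_two_of_even (by lia), show k + 2 - 1 = k + 1 by lia,
      hval (k + 1) (by lia) (by lia)] at hs
    have h := Nat.dvd_gcd hd
      (show d ∣ m + (k + 1) by
        rw [show m + (k + 1) = (m - 1) + (k + 2) by lia]; exact hd'.add hd)
    rw [show Nat.gcd (k + 2) (m + (k + 1)) = 1 by lia] at h
    exact Nat.dvd_one.1 h
  have hodd : ∀ n d, r < n + 2 → n + 2 ≤ m → n % 2 = 1 → d ∣ n → d ∣ m + 1 → d = 1 := by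
    intro n d h1 h2 h3 hd hd'
    have hs := hstep (n + 2) h1 h2
    rw [c_add_two_of_odd h3, show n + 2 - 1 = n + 1 by lia,
      hval (n + 1) (by lia) (by lia)] at hs
    have h := Nat.dvd_gcd hd
      (show d ∣ m + (n + 1) by
        rw [show m + (n + 1) = (m + 1) + n by lia]; exact hd'.add hd)
    rw [show Nat.gcd n (m + (n + 1)) = 1 by lia] at h
    exact Nat.dvd_one.1 h
  have hmeven : m % 2 = 0 := by
    by_contra h
    have := heven (m - 1) 2 (by lia) (by lia) (by lia) (by lia) (by lia)
    lia
  constructor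
  · by_contra hnp
    have hsq := Nat.minFac_sq_le_self (show 0 < m - 1 by lia) hnp
    have hp := Nat.minFac_prime (show m - 1 ≠ 1 by lia)
    have hdvd := Nat.minFac_dvd (m - 1)
    set p := (m - 1).minFac
    have hlt : 2 * p < m - r := by
      apply lt_of_pow_lt_pow_left₀ 2 (Nat.zero_le _)
      have : p ^ 2 < m + 1 := by lia
      nlinarith
    have h1 := Nat.div_add_mod m (2 * p)
    have h2 := Nat.mod_lt m (show 2 * p > 0 by have := hp.pos; lia)
    exact hp.one_lt.ne' (heven (2 * p * (m / (2 * p))) p (by lia) (by lia)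
      (by rw [mul_assoc]; lia) ⟨2 * (m / (2 * p)), by ring⟩ hdvd)
  · by_contra hnp
    have hsq := Nat.minFac_sq_le_self (show 0 < m + 1 by lia) hnp
    have hp := Nat.minFac_prime (show m + 1 ≠ 1 by lia)
    have hdvd := Nat.minFac_dvd (m + 1)
    set p := (m + 1).minFac
    have hle : 2 * p ≤ m - r := by
      apply le_of_pow_le_pow_left₀ two_ne_zero (Nat.zero_le _)
      nlinarith
    have hpodd : p % 2 = 1 := by
      by_contra h
      have : 2 ∣ m + 1 := (show 2 ∣ p by lia).trans hdvd
      lia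
    have hpm : p + 2 ≤ m := by nlinarith
    have h1 := Nat.div_add_mod (m - 2 - p) (2 * p)
    have h2 := Nat.mod_lt (m - 2 - p) (show 2 * p > 0 by have := hp.pos; lia)
    have h3 : (p + 2 * p * ((m - 2 - p) / (2 * p))) % 2 = 1 := by rw [mul_assoc]; lia
    exact hp.one_lt.ne' (hodd (p + 2 * p * ((m - 2 - p) / (2 * p))) p (by lia) (by lia)
      h3 ⟨1 + 2 * ((m - 2 - p) / (2 * p)), by ring⟩ hdvd)

theorem six_dvd_of_prime_pred_of_prime_succ {m : ℕ} (h5 : 5 ≤ m) (h1 : Nat.Prime (m - 1))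
    (h2 : Nat.Prime (m + 1)) : 6 ∣ m := by
  have key : ∀ p q : ℕ, p.Prime → q.Prime → p ∣ q → p = q := fun p q hp hq h =>
    (Nat.prime_dvd_prime_iff_eq hp hq).1 h
  have a := key 2 (m - 1) Nat.prime_two h1
  have b := key 3 (m - 1) Nat.prime_three h1
  have d := key 3 (m + 1) Nat.prime_three h2
  lia

/-- A fundamental point between twin primes is followed by another one, provided the last
nontrivial increment before the next fundamental point `m'` comes early enough. -/
theorem prime_pred_and_prime_succ_of_next_fundamental {m m' : ℕ} (hm138 : 138 ≤ m)
    (hm : IsFundamentalC m) (h6 : 6 ∣ m) (hm' : IsFundamentalC m') (hlt : m < m')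
    (hρ : ∀ ρ : ℕ, ρ ≤ m' → 1 < c ρ - c (ρ - 1) →
      (∀ σ : ℕ, σ ≤ m' → 1 < c σ - c (σ - 1) → σ ≤ ρ) →
      (ρ : ℝ) ≤ (5 / 4 : ℝ) * ((m : ℝ) + 3)) :
    Nat.Prime (m' - 1) ∧ Nat.Prime (m' + 1) := by
  have e1 := c_add_one_of_fundamental hm h6
  have e2 := c_add_two_of_fundamental hm h6
  have e3 := c_add_three_of_fundamental hm h6
  have hle : m + 3 ≤ m' := by
    have n1 : m' ≠ m + 1 := by
      rintro rfl
      have := hm'.2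
      lia
    have n2 : m' ≠ m + 2 := by
      rintro rfl
      have := hm'.2
      lia
    lia
  have hjump : 1 < c (m + 3) - c (m + 3 - 1) := by
    rw [show m + 3 - 1 = m + 2 by lia, e2, e3]
    lia
  classical
  let P : ℕ → Prop := fun σ => 1 < c σ - c (σ - 1)
  obtain ⟨ρ, hρdef⟩ : ∃ ρ, ρ = Nat.findGreatest P m' := ⟨_, rfl⟩
  have hρle : ρ ≤ m' := hρdef ▸ Nat.findGreatest_le m'
  have hρjump : P ρ := hρdef ▸ Nat.findGreatest_spec (P := P) hle hjump
  have hρmax : ∀ σ : ℕ, σ ≤ m' → P σ → σ ≤ ρ := fun σ h1 h2 =>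
    hρdef ▸ Nat.le_findGreatest h1 h2
  have hbound : 4 * ρ ≤ 5 * (m + 3) := by
    have h := hρ ρ hρle hρjump hρmax
    have h' : (4 * ρ : ℝ) ≤ 5 * ((m : ℝ) + 3) := by linarith
    exact_mod_cast h'
  have hgrow := c_add_le (m + 3) (m' - (m + 3))
  rw [Nat.add_sub_cancel' hle, e3, hm'.2] at hgrow
  have hm3 := hρmax _ hle hjump
  refine prime_pred_and_prime_succ_of_fundamental (r := ρ) hm' (by lia) (by lia) hρle ?_ ?_
  · obtain ⟨t, rfl⟩ := Nat.exists_eq_add_of_le hρle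
    rw [Nat.add_sub_cancel_left]
    have : 3 * (ρ + t) ≤ 8 * t + 30 := by lia
    nlinarith
  · intro n h1 h2
    have hn : ¬ P n := fun h => absurd (hρmax n h2 h) (by lia)
    have hlt' := c_lt_c_succ (n - 1)
    rw [show n - 1 + 1 = n by lia] at hlt'
    simp only [P] at hn
    lia

/-- If every fundamental point `m ≥ 138` of `c` is followed by a least fundamental point
`m'`, and the largest index `ρ ≤ m'` of a nontrivial increment satisfies
`ρ ≤ (5/4) (m + 3)`, then there are infinitely many pairs of twin primes. -/
theorem infinitely_many_twin_primes_of_conjecture_four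
    (hyp : ∀ m : ℕ, 138 ≤ m → IsFundamentalC m →
      ∃ m' : ℕ, IsFundamentalC m' ∧ m < m' ∧
        (∀ k : ℕ, IsFundamentalC k → m < k → m' ≤ k) ∧
        ∀ ρ : ℕ, ρ ≤ m' → 1 < c ρ - c (ρ - 1) →
          (∀ σ : ℕ, σ ≤ m' → 1 < c σ - c (σ - 1) → σ ≤ ρ) →
          (ρ : ℝ) ≤ (5 / 4 : ℝ) * ((m : ℝ) + 3)) :
    {p : ℕ | Nat.Prime p ∧ Nat.Prime (p + 2)}.Infinite := by
  have key : ∀ a : ℕ, ∃ m, a < m ∧ 138 ≤ m ∧ IsFundamentalC m ∧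
      Nat.Prime (m - 1) ∧ Nat.Prime (m + 1) := by
    intro a
    induction a with
    | zero =>
      exact ⟨138, by norm_num, le_rfl, isFundamentalC_138, by norm_num, by norm_num⟩
    | succ a ih =>
      obtain ⟨m, ham, h138, hm, hp, hq⟩ := ih
      obtain ⟨m', hm', hlt, -, hρ⟩ := hyp m h138 hm
      exact ⟨m', by lia, by lia, hm', prime_pred_and_prime_succ_of_next_fundamental h138 hm
        (six_dvd_of_prime_pred_of_prime_succ (by lia) hp hq) hm' hlt hρ⟩
  refine Set.infinite_of_forall_exists_gt fun a => ?_
  obtain ⟨m, ham, h138, -, hp, hq⟩ := key (a + 1)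
  exact ⟨m - 1, ⟨hp, by rwa [show m - 1 + 2 = m + 1 by lia]⟩, by lia⟩
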